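/- arXiv:2505.16285 — 2 statements merged into one kernel-verified Lean document; each statement's English description precedes it below -/
import Mathlib

section
/- Let φ : G → H and π : H → Q be group homomorphisms such that the image φ(G) has finite index in H and π is surjective. Suppose that every finite-index subgroup of Q has trivial center. Then π(φ(g)) = 1 for every element g of the center of G; equivalently, φ maps the center of G into the kernel of π. -/
/-- If `φ : G →* H` has finite-index image, `π : H →* Q` is surjective, and
every finite-index subgroup of `Q` has trivial center, then `π ∘ φ` kills the
center of `G`. -/
theorem stmt_5 {G H Q : Type*} [Group G] [Group H] [Group Q]
    (φ : G →* H) (π : H →* Q)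
    (hfin : φ.range.FiniteIndex) (hsurj : Function.Surjective π)
    (hSCF : ∀ K : Subgroup Q, K.FiniteIndex → Subgroup.center K = ⊥) :
    ∀ g ∈ Subgroup.center G, π (φ g) = 1 := by
  intro g hg
  have hK : (φ.range.map π).FiniteIndex := by
    refine ⟨fun h0 => hfin.index_ne_zero ?_⟩
    have hd := Subgroup.index_map_dvd φ.range hsurj
    rw [h0] at hd
    exact Nat.eq_zero_of_zero_dvd hd
  have hmem : π (φ g) ∈ φ.range.map π := ⟨φ g, ⟨g, rfl⟩, rfl⟩
  have hc : (⟨π (φ g), hmem⟩ : φ.range.map π) ∈ Subgroup.center (φ.range.map π) := by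
    rw [Subgroup.mem_center_iff]
    rintro ⟨_, _, ⟨x, rfl⟩, rfl⟩
    apply Subtype.ext
    have := Subgroup.mem_center_iff.1 hg x
    simp only [Subgroup.coe_mul, ← map_mul, this]
  rw [hSCF _ hK, Subgroup.mem_bot] at hc
  exact congrArg Subtype.val hc
end

section
/- Let Γ be a group, and let p : G → Γ and p' : G' → Γ be surjective group homomorphisms whose kernels are infinite cyclic central subgroups: ker p is generated by an element z of infinite order lying in the center of G, and ker p' is generated by an element z' of infinite order lying in the center of G'. Let ψ : G → G' be a group homomorphism satisfying p' ∘ ψ = p and ψ(z) = z'^k for some nonzero integer k. Then ψ is injective, the intersection of the image ψ(G) with the subgroup generated by z' is the subgroup generated by z'^k, and the image ψ(G) has index |k| in G'. -/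
/-- If `p : G →* Γ` and `p' : G' →* Γ` are surjective with kernels generated
by central elements of infinite order `z`, `z'` respectively, and
`ψ : G →* G'` satisfies `p' ∘ ψ = p` and `ψ z = z'^k` with `k ≠ 0`, then `ψ`
is injective, `ψ(G) ∩ ⟨z'⟩ = ⟨z'^k⟩`, and `ψ(G)` has index `|k|` in `G'`. -/
theorem stmt_6 {G G' Γ : Type*} [Group G] [Group G'] [Group Γ]
    (p : G →* Γ) (p' : G' →* Γ)
    (hp : Function.Surjective p) (hp' : Function.Surjective p')
    (z : G) (z' : G')
    (hzord : ¬ IsOfFinOrder z) (hz'ord : ¬ IsOfFinOrder z')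
    (hzc : z ∈ Subgroup.center G) (hz'c : z' ∈ Subgroup.center G')
    (hzker : p.ker = Subgroup.zpowers z) (hz'ker : p'.ker = Subgroup.zpowers z')
    (ψ : G →* G') (hcomm : p'.comp ψ = p)
    (k : ℤ) (hk : k ≠ 0) (hψz : ψ z = z' ^ k) :
    Function.Injective ψ ∧
    ψ.range ⊓ Subgroup.zpowers z' = Subgroup.zpowers (z' ^ k) ∧
    ψ.range.index = k.natAbs := by
  have hc : ∀ g, p' (ψ g) = p g := fun g => by rw [← hcomm]; rfl
  have hinj' : Function.Injective (fun n : ℤ => z' ^ n) := injective_zpow_iff_not_isOfFinOrder.mpr hz'ord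
  have key : ∀ g, ∀ n : ℤ, ψ g = z' ^ n → ∃ m : ℤ, g = z ^ m ∧ n = k * m := by
    intro g n h
    have hg : g ∈ p.ker := by
      have h1 : z' ^ n ∈ p'.ker := by
        rw [hz'ker]; exact ⟨n, rfl⟩
      rw [MonoidHom.mem_ker, ← hc, h]; exact h1
    rw [hzker] at hg
    obtain ⟨m, rfl⟩ := hg
    refine ⟨m, rfl, hinj' ?_⟩
    simp only [map_zpow, hψz] at h
    simp only [zpow_mul]
    exact h.symm
  have hmem : ∀ n : ℤ, z' ^ n ∈ ψ.range ↔ k ∣ n := by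
    intro n
    constructor
    · rintro ⟨g, hg⟩
      obtain ⟨m, -, hm⟩ := key g n hg
      exact ⟨m, hm⟩
    · rintro ⟨m, rfl⟩
      exact ⟨z ^ m, by rw [map_zpow, hψz, zpow_mul]⟩
  have hdec : ∀ x : G', ∃ g, ∃ n : ℤ, x = ψ g * z' ^ n := by
    intro x
    obtain ⟨g, hg⟩ := hp (p' x)
    have h1 : (ψ g)⁻¹ * x ∈ p'.ker := by
      rw [MonoidHom.mem_ker, map_mul, map_inv, hc, hg, inv_mul_cancel]
    rw [hz'ker] at h1
    obtain ⟨n, hn⟩ := h1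
    refine ⟨g, n, ?_⟩
    simp only at hn
    rw [hn, mul_inv_cancel_left]
  refine ⟨?_, ?_, ?_⟩
  · rw [injective_iff_map_eq_one]
    intro g hg
    obtain ⟨m, rfl, hm⟩ := key g 0 (by simpa using hg)
    have : m = 0 := by
      rcases mul_eq_zero.mp hm.symm with h | h
      · exact absurd h hk
      · exact h
    simp [this]
  · ext x
    constructor
    · rintro ⟨hx, n, rfl⟩
      obtain ⟨m, rfl⟩ := (hmem n).1 hx
      exact ⟨m, by simp only [zpow_mul]⟩
    · rintro ⟨m, rfl⟩
      simp only [← zpow_mul]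
      exact ⟨(hmem _).2 ⟨m, rfl⟩, _, rfl⟩
  · have hN : ψ.range.Normal := by
      constructor
      rintro _ ⟨a, rfl⟩ x
      obtain ⟨g, n, rfl⟩ := hdec x
      have h2 := Subgroup.mem_center_iff.mp (Subgroup.zpow_mem _ hz'c n) (ψ a)
      refine ⟨g * a * g⁻¹, ?_⟩
      rw [mul_inv_rev, mul_assoc (ψ g), ← h2]
      simp [mul_assoc]
    have htop : Subgroup.zpowers z' ⊔ ψ.range = ⊤ := by
      rw [eq_top_iff]
      intro x _
      obtain ⟨g, n, rfl⟩ := hdec x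
      exact mul_mem (Subgroup.mem_sup_right ⟨g, rfl⟩) (Subgroup.mem_sup_left ⟨n, rfl⟩)
    have h3 : ψ.range.index = ψ.range.relIndex (zpowersHom G' z').range := by
      have : (zpowersHom G' z').range = Subgroup.zpowers z' := rfl
      rw [this, ← Subgroup.relIndex_top_right, ← htop]
      first | exact Subgroup.relIndex_sup_right _ _ | exact Subgroup.relIndex_sup_left _ _
    rw [h3, ← Subgroup.index_comap]
    have h4 : Subgroup.comap (zpowersHom G' z') ψ.range
        = AddSubgroup.toSubgroup (AddSubgroup.zmultiples k) := by
      ext n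
      rw [Subgroup.mem_comap]
      change z' ^ (Multiplicative.toAdd n) ∈ ψ.range ↔ Multiplicative.toAdd n ∈ AddSubgroup.zmultiples k
      rw [hmem, Int.mem_zmultiples_iff]
    rw [h4, AddSubgroup.index_toSubgroup, Int.index_zmultiples]
end
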